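/- Assume Hypothesis A, let n ≥ 0 be an integer with ∫_{ℝ³} |k|^{2(1+n)} φ̂(k) dk < ∞, and let γ : [0,1] → ℝ³ be a closed absolutely continuous curve with derivative γ' ∈ L²((0,1); ℝ³). Then the induced velocity u is n-times continuously differentiable and its n-th derivative satisfies the uniform bound sup_{x∈ℝ³} ‖Dⁿu(x)‖ ≤ (1/(2π^{3/2})) (∫_{ℝ³} |k|^{2(1+n)} φ̂(k) dk)^{1/2} H(γ)^{1/2}. -/

import Mathlib

noncomputable section
open MeasureTheory Real Set

/-- Three-dimensional Euclidean space. -/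
abbrev E3 := EuclideanSpace ℝ (Fin 3)

/-- The Fourier transform `∫_{ℝ³} e^{i⟨k,x⟩} f(x) dx` of `f : ℝ³ → ℝ`, as a complex number. -/
def fourierInt (f : E3 → ℝ) (k : E3) : ℂ :=
  ∫ x : E3, Complex.exp (Complex.I * ((inner ℝ k x : ℝ) : ℂ)) * (f x : ℂ)

/-- Hypothesis A: `φ` is even, continuous, integrable, its Fourier transform is the real
nonnegative function `φhat`, and `φhat` satisfies the moment condition (A.4). -/
structure HypA (φ : E3 → ℝ) (φhat : E3 → ℝ) : Prop where
  even : ∀ x, φ (-x) = φ x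
  cont : Continuous φ
  integrable : Integrable φ
  fourier_eq : ∀ k, (φhat k : ℂ) = fourierInt φ k
  nonneg : ∀ k, 0 ≤ φhat k
  moment : Integrable (fun k : E3 => (1 + ‖k‖ ^ 2) ^ 2 * φhat k)

/-- `γ : [0,1] → ℝ³` is a closed curve, absolutely continuous with derivative `γd`
belonging to `L²((0,1); ℝ³)`. -/
structure IsH1Loop (γ γd : ℝ → E3) : Prop where
  closed : γ 0 = γ 1
  deriv_eq : ∀ ξ ∈ Icc (0:ℝ) 1, γ ξ = γ 0 + ∫ s in (0:ℝ)..ξ, γd s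
  memL2 : MemLp γd 2 (volume.restrict (Ioc (0:ℝ) 1))

/-- The kinetic energy `H(γ) = (1/2)∫₀¹∫₀¹ φ(γ(ξ)-γ(η)) ⟨γ'(ξ), γ'(η)⟩ dξ dη`. -/
def energy (φ : E3 → ℝ) (γ γd : ℝ → E3) : ℝ :=
  (1 / 2) * ∫ ξ in (0:ℝ)..1, ∫ η in (0:ℝ)..1, φ (γ ξ - γ η) * (inner ℝ (γd ξ) (γd η) : ℝ)

/-- The cross product on `ℝ³`. -/
def cross3 (a b : E3) : E3 := WithLp.toLp 2 (crossProduct (WithLp.ofLp a) (WithLp.ofLp b))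

/-- The induced velocity `u(x) = ∫₀¹ ∇φ(x - γ(ξ)) ∧ γ'(ξ) dξ`. -/
def velocity (φ : E3 → ℝ) (γ γd : ℝ → E3) (x : E3) : E3 :=
  ∫ ξ in (0:ℝ)..1, cross3 (gradient φ (x - γ ξ)) (γd ξ)

open scoped FourierTransform

/-! ### The cross product as a bounded bilinear map -/

lemma norm_cross3_le (a b : E3) : ‖cross3 a b‖ ≤ ‖a‖ * ‖b‖ := by
  refine le_of_sq_le_sq ?_ (by positivity)
  rw [mul_pow, EuclideanSpace.real_norm_sq_eq, EuclideanSpace.real_norm_sq_eq,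
    EuclideanSpace.real_norm_sq_eq]
  simp only [cross3, cross_apply, Fin.sum_univ_three, Matrix.cons_val]
  nlinarith [sq_nonneg (a 0 * b 0 + a 1 * b 1 + a 2 * b 2)]

/-- The cross product as a continuous bilinear map. -/
def crossCLM : E3 →L[ℝ] E3 →L[ℝ] E3 :=
  LinearMap.mkContinuous₂
    (LinearMap.mk₂ ℝ cross3
      (fun a b c => by simp [cross3]) (fun r a b => by simp [cross3])
      (fun a b c => by simp [cross3]) (fun r a b => by simp [cross3]))
    1 (fun a b => by rw [one_mul]; exact norm_cross3_le a b)

@[simp] lemma crossCLM_apply (a b : E3) : crossCLM a b = cross3 a b := rfl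

/-! ### Pairs of real vectors as complex vectors -/

/-- The space `ℂ³` with its Hermitian norm. -/
abbrev C3 := EuclideanSpace ℂ (Fin 3)

/-- The complex vector `a + i b`. -/
def complexVec (a b : E3) : C3 := WithLp.toLp 2 fun j => (⟨a j, b j⟩ : ℂ)

lemma norm_complexVec_sq (a b : E3) : ‖complexVec a b‖ ^ 2 = ‖a‖ ^ 2 + ‖b‖ ^ 2 := by
  simp only [EuclideanSpace.norm_sq_eq, complexVec, ← Finset.sum_add_distrib, Complex.sq_norm,
    Complex.normSq_mk, Real.norm_eq_abs, sq_abs, ← sq]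

lemma continuous_complexVec : Continuous fun p : E3 × E3 => complexVec p.1 p.2 := by
  unfold complexVec
  refine (PiLp.continuous_toLp 2 _).comp (continuous_pi fun j => ?_)
  have h : (fun p : E3 × E3 => (⟨p.1 j, p.2 j⟩ : ℂ)) =
      fun p : E3 × E3 => (p.1 j : ℂ) + (p.2 j : ℂ) * Complex.I := by
    ext p; exact Complex.mk_eq_add_mul_I _ _
  rw [h]
  fun_prop

/-- The real part of a complex vector. -/
def reVec : C3 →L[ℝ] E3 :=
  LinearMap.mkContinuous
    { toFun := fun z => WithLp.toLp 2 fun j => (z j).re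
      map_add' := fun z w => by ext j; simp
      map_smul' := fun r z => by ext j; simp } 1 fun z => by
    refine le_of_sq_le_sq ?_ (by positivity)
    simp only [one_mul, EuclideanSpace.norm_sq_eq, LinearMap.coe_mk, AddHom.coe_mk]
    gcongr with j
    exact Complex.abs_re_le_norm _

lemma norm_reVec_le : ‖reVec‖ ≤ 1 := LinearMap.mkContinuous_norm_le _ zero_le_one _

lemma reVec_apply (z : C3) (j : Fin 3) : reVec z j = (z j).re := rfl

lemma reVec_exp_smul_complexVec (θ : ℝ) (a b : E3) :
    reVec (Complex.exp (-θ * Complex.I) • complexVec a b) =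
      Real.cos θ • a + Real.sin θ • b := by
  ext j
  rw [reVec_apply, ← Complex.ofReal_neg, Complex.exp_mul_I, ← Complex.ofReal_cos,
    ← Complex.ofReal_sin]
  simp only [PiLp.smul_apply, complexVec, smul_eq_mul, Complex.mul_re, Complex.add_re,
    Complex.add_im, Complex.mul_im, Complex.I_re, Complex.I_im, Complex.ofReal_re,
    Complex.ofReal_im, Real.cos_neg, Real.sin_neg, PiLp.add_apply]
  ring

/-! ### Fourier inversion -/

section Inversion

variable {φ φhat : E3 → ℝ}

lemma HypA.phat_eq_fourier (hA : HypA φ φhat) (v : E3) :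
    𝓕 (fun x => (φ x : ℂ)) v = φhat ((-(2 * π)) • v) := by
  rw [hA.fourier_eq, Real.fourier_eq', fourierInt]
  refine integral_congr_ae (.of_forall fun x => ?_)
  simp only [smul_eq_mul, inner_smul_left, real_inner_comm]
  congr 2
  simp
  ring

lemma HypA.continuous_hat (hA : HypA φ φhat) : Continuous φhat := by
  have h : Continuous (𝓕 (fun x => (φ x : ℂ))) :=
    VectorFourier.fourierIntegral_continuous Real.continuous_fourierChar
      (innerSL ℝ).continuous₂ hA.integrable.ofReal
  have h' : φhat = fun k => (𝓕 (fun x => (φ x : ℂ)) ((-(2 * π))⁻¹ • k)).re := by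
    ext k
    rw [hA.phat_eq_fourier, smul_inv_smul₀ (by simp [pi_ne_zero]), Complex.ofReal_re]
  rw [h']
  fun_prop

lemma HypA.integrable_pow_mul_hat (hA : HypA φ φhat) {m : ℕ} (hm : m ≤ 2) :
    Integrable fun k => ‖k‖ ^ m * φhat k := by
  have hc := hA.continuous_hat
  refine hA.moment.mono' (by fun_prop) (.of_forall fun k => ?_)
  rw [norm_mul, Real.norm_of_nonneg (hA.nonneg k), Real.norm_of_nonneg (by positivity)]
  gcongr
  · exact hA.nonneg k
  · have := norm_nonneg k
    interval_cases m <;> nlinarith [sq_nonneg (‖k‖ - 1), sq_nonneg (‖k‖ ^ 2)]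

lemma HypA.integrable_hat (hA : HypA φ φhat) : Integrable φhat := by
  simpa using hA.integrable_pow_mul_hat (m := 0) (by norm_num)

lemma HypA.integrable_norm_mul_hat (hA : HypA φ φhat) : Integrable fun k => ‖k‖ * φhat k := by
  simpa using hA.integrable_pow_mul_hat (m := 1) (by norm_num)

/-- Fourier inversion, in real form. -/
lemma HypA.eq_integral_cos (hA : HypA φ φhat) (x : E3) :
    φ x = ((2 * π) ^ 3)⁻¹ * ∫ k, φhat k * Real.cos (inner ℝ k x) := by
  have hpi : -(2 * π) ≠ 0 := by simp [pi_ne_zero]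
  have hi : Integrable (𝓕 (fun x => (φ x : ℂ))) := by
    rw [funext hA.phat_eq_fourier]
    exact ((integrable_comp_smul_iff volume φhat hpi).2 hA.integrable_hat).ofReal
  have hc : Continuous fun x => (φ x : ℂ) := Complex.continuous_ofReal.comp hA.cont
  have h := congrFun (hc.fourierInv_fourier_eq hA.integrable.ofReal hi) x
  rw [Real.fourierInv_eq', funext hA.phat_eq_fourier] at h
  have hre := congrArg Complex.re h
  rw [Complex.ofReal_re, ← RCLike.re_eq_complex_re, ← integral_re] at hre
  · rw [← hre]
    have hcov := Measure.integral_comp_smul (volume : Measure E3)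
      (fun k => φhat k * Real.cos (inner ℝ k x)) (-(2 * π))
    rw [finrank_euclideanSpace_fin, smul_eq_mul, abs_inv, abs_pow, abs_neg,
      abs_of_pos (show (0 : ℝ) < 2 * π by positivity)] at hcov
    rw [← hcov]
    refine integral_congr_ae (.of_forall fun v => ?_)
    simp only [RCLike.re_eq_complex_re, smul_eq_mul, Complex.re_mul_ofReal,
      Complex.exp_ofReal_mul_I_re, real_inner_smul_left, neg_mul, Real.cos_neg]
    ring
  · rw [funext hA.phat_eq_fourier] at hi
    have hhat := hA.continuous_hat
    refine hi.norm.mono' (by fun_prop) (.of_forall fun v => ?_)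
    rw [norm_smul, Complex.norm_exp_ofReal_mul_I, one_mul]

lemma HypA.integrable_sin_smul_id (hA : HypA φ φhat) (x : E3) :
    Integrable fun k => (-((2 * π) ^ 3)⁻¹ * φhat k * Real.sin (inner ℝ k x)) • k := by
  have hc := hA.continuous_hat
  set c : ℝ := ((2 * π) ^ 3)⁻¹
  refine (hA.integrable_norm_mul_hat.const_mul |c|).mono' (by fun_prop) (.of_forall fun k => ?_)
  rw [norm_smul, norm_mul, norm_mul, Real.norm_of_nonneg (hA.nonneg k), norm_neg,
    Real.norm_eq_abs, Real.norm_eq_abs]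
  have h1 := Real.abs_sin_le_one (inner ℝ k x)
  have h2 := hA.nonneg k
  calc _ ≤ |c| * φhat k * 1 * ‖k‖ := by gcongr
    _ = _ := by ring

lemma HypA.hasGradientAt (hA : HypA φ φhat) (x : E3) :
    HasGradientAt φ
      (∫ k, (-((2 * π) ^ 3)⁻¹ * φhat k * Real.sin (inner ℝ k x)) • k) x := by
  have hc := hA.continuous_hat
  set c : ℝ := ((2 * π) ^ 3)⁻¹
  have hi := hA.integrable_sin_smul_id x
  have hφ : φ = fun y => ∫ k, c * (φhat k * Real.cos (inner ℝ k y)) := by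
    ext y
    rw [hA.eq_integral_cos y, integral_const_mul]
  rw [hasGradientAt_iff_hasFDerivAt]
  have hdual : (InnerProductSpace.toDual ℝ E3)
      (∫ k, (-c * φhat k * Real.sin (inner ℝ k x)) • k) =
      ∫ k, (-c * φhat k * Real.sin (inner ℝ k x)) • (innerSL ℝ k : E3 →L[ℝ] ℝ) := by
    have := (innerSL ℝ : E3 →L[ℝ] E3 →L[ℝ] ℝ).integral_comp_comm hi
    simp only [map_smul] at this
    rw [this]
    rfl
  rw [hdual, hφ]
  refine hasFDerivAt_integral_of_dominated_of_fderiv_le (s := univ)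
    (F' := fun y k => (-c * φhat k * Real.sin (inner ℝ k y)) • (innerSL ℝ k : E3 →L[ℝ] ℝ))
    (bound := fun k => |c| * (‖k‖ * φhat k)) Filter.univ_mem
    (.of_forall fun y => by fun_prop) ?_ (by fun_prop) ?_
    (hA.integrable_norm_mul_hat.const_mul |c|) ?_
  · refine (hA.integrable_hat.const_mul |c|).mono' (by fun_prop) (.of_forall fun k => ?_)
    rw [norm_mul, norm_mul, Real.norm_of_nonneg (hA.nonneg k), Real.norm_eq_abs, Real.norm_eq_abs]
    have h1 := Real.abs_cos_le_one (inner ℝ k x)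
    have h2 := hA.nonneg k
    calc _ ≤ |c| * (φhat k * 1) := by gcongr
      _ = _ := by ring
  · refine .of_forall fun k y _ => ?_
    rw [norm_smul, norm_mul, norm_mul, Real.norm_of_nonneg (hA.nonneg k), norm_neg,
      Real.norm_eq_abs, Real.norm_eq_abs, innerSL_apply_norm]
    have h1 := Real.abs_sin_le_one (inner ℝ k y)
    have h2 := hA.nonneg k
    calc _ ≤ |c| * φhat k * 1 * ‖k‖ := by gcongr
      _ = _ := by ring
  · refine .of_forall fun k y _ => ?_
    have h1 : HasFDerivAt (fun y : E3 => (inner ℝ k y : ℝ)) (innerSL ℝ k) y :=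
      (innerSL ℝ k : E3 →L[ℝ] ℝ).hasFDerivAt
    convert! ((h1.cos.const_mul (φhat k)).const_mul c) using 1
    ext w
    simp
    ring

end Inversion

/-! ### Trigonometric moments of a curve -/

section Moments

variable {φ φhat : E3 → ℝ} {μ : Measure ℝ} {γ γd : ℝ → E3}

/-- The real part `∫ cos⟨k, γ⟩ γ'` of the Fourier transform of the current carried by `γ`. -/
def cosMoment (μ : Measure ℝ) (γ γd : ℝ → E3) (k : E3) : E3 :=
  ∫ ξ, Real.cos (inner ℝ k (γ ξ)) • γd ξ ∂μ

/-- The imaginary part `∫ sin⟨k, γ⟩ γ'` of the Fourier transform of the current carried by `γ`. -/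
def sinMoment (μ : Measure ℝ) (γ γd : ℝ → E3) (k : E3) : E3 :=
  ∫ ξ, Real.sin (inner ℝ k (γ ξ)) • γd ξ ∂μ

/-- The Fourier transform `∫ e^{i⟨k, γ⟩} γ'` of the current carried by `γ`. -/
def currentHat (μ : Measure ℝ) (γ γd : ℝ → E3) (k : E3) : C3 :=
  complexVec (cosMoment μ γ γd k) (sinMoment μ γ γd k)

lemma integrable_cos_smul (hm : AEStronglyMeasurable γ μ) (hd : Integrable γd μ) (k : E3) :
    Integrable (fun ξ => Real.cos (inner ℝ k (γ ξ)) • γd ξ) μ := by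
  refine hd.norm.mono' ?_ (.of_forall fun ξ => ?_)
  · exact (by fun_prop : Continuous fun v : E3 => Real.cos (inner ℝ k v)).comp_aestronglyMeasurable
      hm |>.smul hd.1
  · rw [norm_smul]
    exact mul_le_of_le_one_left (norm_nonneg _) (Real.abs_cos_le_one _)

lemma integrable_sin_smul (hm : AEStronglyMeasurable γ μ) (hd : Integrable γd μ) (k : E3) :
    Integrable (fun ξ => Real.sin (inner ℝ k (γ ξ)) • γd ξ) μ := by
  refine hd.norm.mono' ?_ (.of_forall fun ξ => ?_)
  · exact (by fun_prop : Continuous fun v : E3 => Real.sin (inner ℝ k v)).comp_aestronglyMeasurable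
      hm |>.smul hd.1
  · rw [norm_smul]
    exact mul_le_of_le_one_left (norm_nonneg _) (Real.abs_sin_le_one _)

lemma norm_cosMoment_le (hd : Integrable γd μ) (k : E3) :
    ‖cosMoment μ γ γd k‖ ≤ ∫ ξ, ‖γd ξ‖ ∂μ :=
  norm_integral_le_of_norm_le hd.norm (.of_forall fun ξ => by
    rw [norm_smul]
    exact mul_le_of_le_one_left (norm_nonneg _) (Real.abs_cos_le_one _))

lemma norm_sinMoment_le (hd : Integrable γd μ) (k : E3) :
    ‖sinMoment μ γ γd k‖ ≤ ∫ ξ, ‖γd ξ‖ ∂μ :=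
  norm_integral_le_of_norm_le hd.norm (.of_forall fun ξ => by
    rw [norm_smul]
    exact mul_le_of_le_one_left (norm_nonneg _) (Real.abs_sin_le_one _))

lemma norm_currentHat_sq_le (hd : Integrable γd μ) (k : E3) :
    ‖currentHat μ γ γd k‖ ^ 2 ≤ 2 * (∫ ξ, ‖γd ξ‖ ∂μ) ^ 2 := by
  rw [currentHat, norm_complexVec_sq, two_mul]
  gcongr
  · exact norm_cosMoment_le hd k
  · exact norm_sinMoment_le hd k

variable [SFinite μ]

lemma aestronglyMeasurable_cosMoment (hm : AEStronglyMeasurable γ μ) (hd : Integrable γd μ) :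
    AEStronglyMeasurable (cosMoment μ γ γd) := by
  have h : AEStronglyMeasurable (fun p : E3 × ℝ => Real.cos (inner ℝ p.1 (γ p.2)) • γd p.2)
      (volume.prod μ) :=
    (Real.continuous_cos.comp_aestronglyMeasurable
      (continuous_fst.aestronglyMeasurable.inner hm.comp_snd)).smul hd.1.comp_snd
  exact h.integral_prod_right'

lemma aestronglyMeasurable_sinMoment (hm : AEStronglyMeasurable γ μ) (hd : Integrable γd μ) :
    AEStronglyMeasurable (sinMoment μ γ γd) := by
  have h : AEStronglyMeasurable (fun p : E3 × ℝ => Real.sin (inner ℝ p.1 (γ p.2)) • γd p.2)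
      (volume.prod μ) :=
    (Real.continuous_sin.comp_aestronglyMeasurable
      (continuous_fst.aestronglyMeasurable.inner hm.comp_snd)).smul hd.1.comp_snd
  exact h.integral_prod_right'

lemma aestronglyMeasurable_currentHat (hm : AEStronglyMeasurable γ μ) (hd : Integrable γd μ) :
    AEStronglyMeasurable (currentHat μ γ γd) :=
  continuous_complexVec.comp_aestronglyMeasurable
    ((aestronglyMeasurable_cosMoment hm hd).prodMk (aestronglyMeasurable_sinMoment hm hd))

lemma HypA.integrable_currentHat_sq (hA : HypA φ φhat) (hm : AEStronglyMeasurable γ μ)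
    (hd : Integrable γd μ) :
    Integrable fun k => φhat k * ‖currentHat μ γ γd k‖ ^ 2 := by
  refine (hA.integrable_hat.mul_const (2 * (∫ ξ, ‖γd ξ‖ ∂μ) ^ 2)).mono'
    (hA.continuous_hat.aestronglyMeasurable.mul
      ((aestronglyMeasurable_currentHat hm hd).norm.pow 2)) (.of_forall fun k => ?_)
  rw [Real.norm_of_nonneg (mul_nonneg (hA.nonneg k) (sq_nonneg _))]
  exact mul_le_mul_of_nonneg_left (norm_currentHat_sq_le hd k) (hA.nonneg k)

/-- The energy double integral in Fourier variables. -/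
lemma HypA.integral_integral_eq (hA : HypA φ φhat) (hm : AEStronglyMeasurable γ μ)
    (hd : Integrable γd μ) :
    ∫ ξ, ∫ η, φ (γ ξ - γ η) * (inner ℝ (γd ξ) (γd η) : ℝ) ∂μ ∂μ =
      ((2 * π) ^ 3)⁻¹ * ∫ k, φhat k * ‖currentHat μ γ γd k‖ ^ 2 := by
  set F : ℝ × ℝ → E3 → ℝ := fun p k =>
    φhat k * Real.cos (inner ℝ k (γ p.1 - γ p.2)) * inner ℝ (γd p.1) (γd p.2) with hF
  have hFi : Integrable (Function.uncurry F) ((μ.prod μ).prod volume) := by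
    have hb := (hd.norm.mul_prod hd.norm).mul_prod hA.integrable_hat
    refine hb.mono' ?_ (.of_forall fun q => ?_)
    · have h1 : AEStronglyMeasurable (fun q : (ℝ × ℝ) × E3 => γ q.1.1) ((μ.prod μ).prod volume) :=
        (hm.comp_fst (ν := μ)).comp_fst
      have h2 : AEStronglyMeasurable (fun q : (ℝ × ℝ) × E3 => γ q.1.2) ((μ.prod μ).prod volume) :=
        (hm.comp_snd (μ := μ)).comp_fst
      have h3 : AEStronglyMeasurable (fun q : (ℝ × ℝ) × E3 => γd q.1.1) ((μ.prod μ).prod volume) :=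
        (hd.1.comp_fst (ν := μ)).comp_fst
      have h4 : AEStronglyMeasurable (fun q : (ℝ × ℝ) × E3 => γd q.1.2) ((μ.prod μ).prod volume) :=
        (hd.1.comp_snd (μ := μ)).comp_fst
      exact (((hA.continuous_hat.comp continuous_snd).aestronglyMeasurable).mul
        (Real.continuous_cos.comp_aestronglyMeasurable
          (continuous_snd.aestronglyMeasurable.inner (h1.sub h2)))).mul (h3.inner h4)
    · simp only [Function.uncurry, hF]
      rw [norm_mul, norm_mul, Real.norm_of_nonneg (hA.nonneg _)]
      have h1 : ‖Real.cos (inner ℝ q.2 (γ q.1.1 - γ q.1.2))‖ ≤ 1 := Real.abs_cos_le_one _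
      have h2 : ‖(inner ℝ (γd q.1.1) (γd q.1.2) : ℝ)‖ ≤ ‖γd q.1.1‖ * ‖γd q.1.2‖ :=
        norm_inner_le_norm _ _
      have h3 := hA.nonneg q.2
      calc _ ≤ φhat q.2 * 1 * (‖γd q.1.1‖ * ‖γd q.1.2‖) := by gcongr
        _ = _ := by ring
  have hpoint : ∀ p : ℝ × ℝ, φ (γ p.1 - γ p.2) * (inner ℝ (γd p.1) (γd p.2) : ℝ) =
      ((2 * π) ^ 3)⁻¹ * ∫ k, F p k := by
    intro p
    rw [hA.eq_integral_cos, mul_assoc, ← integral_mul_const]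
  have hint : Integrable (fun p : ℝ × ℝ => φ (γ p.1 - γ p.2) * (inner ℝ (γd p.1) (γd p.2) : ℝ))
      (μ.prod μ) := by
    simp_rw [hpoint]
    exact hFi.integral_prod_left.const_mul _
  rw [← integral_prod _ hint]
  simp_rw [hpoint]
  rw [integral_const_mul, integral_integral_swap hFi]
  congr 1
  refine integral_congr_ae (.of_forall fun k => ?_)
  have hC := integrable_cos_smul hm hd k
  have hS := integrable_sin_smul hm hd k
  have hinner : ∀ {f : ℝ → E3}, Integrable f μ →
      Integrable (fun p : ℝ × ℝ => (inner ℝ (f p.1) (f p.2) : ℝ)) (μ.prod μ) := by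
    intro f hf
    refine (hf.norm.mul_prod hf.norm).mono' (hf.1.comp_fst.inner hf.1.comp_snd)
      (.of_forall fun p => norm_inner_le_norm _ _)
  have hsq : ∀ {f : ℝ → E3}, Integrable f μ →
      ∫ p : ℝ × ℝ, (inner ℝ (f p.1) (f p.2) : ℝ) ∂(μ.prod μ) = ‖∫ ξ, f ξ ∂μ‖ ^ 2 := by
    intro f hf
    rw [integral_prod _ (hinner hf), ← real_inner_self_eq_norm_sq]
    simp_rw [integral_inner hf]
    simp_rw [real_inner_comm (∫ η, f η ∂μ)]
    exact integral_inner hf _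
  have hsplit : ∀ p : ℝ × ℝ, F p k = φhat k *
      (inner ℝ (Real.cos (inner ℝ k (γ p.1)) • γd p.1) (Real.cos (inner ℝ k (γ p.2)) • γd p.2) +
       inner ℝ (Real.sin (inner ℝ k (γ p.1)) • γd p.1) (Real.sin (inner ℝ k (γ p.2)) • γd p.2)) := by
    intro p
    simp only [hF, inner_sub_right, Real.cos_sub, real_inner_smul_left, real_inner_smul_right]
    ring
  simp_rw [hsplit]
  rw [integral_const_mul, integral_add (hinner hC) (hinner hS), hsq hC, hsq hS, currentHat,
    norm_complexVec_sq]
  rfl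

/-- The velocity in Fourier variables. -/
lemma HypA.integral_cross3_gradient (hA : HypA φ φhat) (hm : AEStronglyMeasurable γ μ)
    (hd : Integrable γd μ) (x : E3) :
    ∫ ξ, cross3 (gradient φ (x - γ ξ)) (γd ξ) ∂μ =
      ∫ k, (((2 * π) ^ 3)⁻¹ * φhat k) • (Real.cos (inner ℝ k x) • cross3 k (sinMoment μ γ γd k) +
        Real.sin (inner ℝ k x) • -cross3 k (cosMoment μ γ γd k)) := by
  set c : ℝ := ((2 * π) ^ 3)⁻¹
  set G : ℝ → E3 → E3 := fun ξ k =>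
    (-c * φhat k * Real.sin (inner ℝ k (x - γ ξ))) • cross3 k (γd ξ) with hG
  have hcont := hA.continuous_hat
  have hpoint : ∀ ξ, cross3 (gradient φ (x - γ ξ)) (γd ξ) = ∫ k, G ξ k := by
    intro ξ
    rw [(hA.hasGradientAt (x - γ ξ)).gradient]
    have h := (crossCLM.flip (γd ξ)).integral_comp_comm (hA.integrable_sin_smul_id (x - γ ξ))
    simp only [map_smul] at h
    exact h.symm
  have hGi : Integrable (Function.uncurry G) (μ.prod volume) := by
    refine ((hd.norm.mul_prod hA.integrable_norm_mul_hat).const_mul |c|).mono' ?_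
      (.of_forall fun q => ?_)
    · refine AEStronglyMeasurable.smul (((hcont.comp continuous_snd).aestronglyMeasurable.const_mul
        (-c)).mul (Real.continuous_sin.comp_aestronglyMeasurable
          (continuous_snd.aestronglyMeasurable.inner
            (aestronglyMeasurable_const.sub hm.comp_fst)))) ?_
      exact crossCLM.continuous₂.comp_aestronglyMeasurable
        (continuous_snd.aestronglyMeasurable.prodMk hd.1.comp_fst)
    · simp only [Function.uncurry, hG]
      rw [norm_smul, norm_mul, norm_mul, Real.norm_of_nonneg (hA.nonneg _), norm_neg,
        Real.norm_eq_abs, Real.norm_eq_abs]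
      have h1 := Real.abs_sin_le_one (inner ℝ q.2 (x - γ q.1))
      have h2 := hA.nonneg q.2
      calc _ ≤ |c| * φhat q.2 * 1 * (‖q.2‖ * ‖γd q.1‖) := by
            gcongr
            exact norm_cross3_le _ _
        _ = _ := by ring
  simp_rw [hpoint]
  rw [integral_integral_swap hGi]
  refine integral_congr_ae (.of_forall fun k => ?_)
  have hC := (integrable_cos_smul hm hd k).fun_smul (Real.sin (inner ℝ k x))
  have hS := (integrable_sin_smul hm hd k).fun_smul (Real.cos (inner ℝ k x))
  have hSC := hS.sub hC
  rw [Pi.sub_def] at hSC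
  have hsplit : ∀ ξ, G ξ k = (c * φhat k) • (crossCLM k)
      (Real.cos (inner ℝ k x) • (Real.sin (inner ℝ k (γ ξ)) • γd ξ) -
        Real.sin (inner ℝ k x) • (Real.cos (inner ℝ k (γ ξ)) • γd ξ)) := by
    intro ξ
    simp only [hG, inner_sub_right, Real.sin_sub, map_sub, map_smul, crossCLM_apply]
    module
  simp_rw [hsplit]
  rw [integral_smul, (crossCLM k).integral_comp_comm hSC,
    integral_sub hS hC, integral_smul, integral_smul, map_sub, map_smul, map_smul]
  simp only [crossCLM_apply, sinMoment, cosMoment, smul_neg, sub_eq_add_neg]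

end Moments

/-! ### Smoothness and bounds through the Fourier representation -/

/-- The pairing `⟨k, x⟩ / 2π`, which turns `Real.fourierChar` into `e^{i⟨k, x⟩}`. -/
def scaledInner : E3 →L[ℝ] E3 →L[ℝ] ℝ := (2 * π)⁻¹ • innerSL ℝ

lemma scaledInner_apply (k x : E3) : scaledInner k x = (2 * π)⁻¹ * inner ℝ k x := rfl

lemma two_pi_mul_norm_scaledInner_le : 2 * π * ‖scaledInner‖ ≤ 1 := by
  have hpi : 0 < 2 * π := by positivity
  have h : ‖scaledInner‖ ≤ (2 * π)⁻¹ := by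
    refine ContinuousLinearMap.opNorm_le_bound₂ _ (by positivity) fun k x => ?_
    rw [scaledInner_apply, norm_mul, norm_inv, Real.norm_of_nonneg hpi.le, mul_assoc]
    gcongr
    exact norm_inner_le_norm k x
  calc _ ≤ 2 * π * (2 * π)⁻¹ := by gcongr
    _ = 1 := mul_inv_cancel₀ (ne_of_gt hpi)

/-- An inverse-Fourier-type integral `∫ e^{-i⟨k, x⟩} g(k) dk` with `n` absolute moments is `Cⁿ`,
with `n`-th derivative bounded by the `n`-th moment. -/
lemma contDiff_and_norm_iteratedFDeriv_le {g : E3 → C3} {n : ℕ} (hg : AEStronglyMeasurable g)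
    (hi : ∀ m ≤ n, Integrable fun k => ‖k‖ ^ m * ‖g k‖) :
    let u : E3 → C3 := fun x => ∫ k, Complex.exp (-(inner ℝ k x : ℝ) * Complex.I) • g k
    ContDiff ℝ (n : ℕ∞) u ∧ ∀ x, ‖iteratedFDeriv ℝ n u x‖ ≤ ∫ k, ‖k‖ ^ n * ‖g k‖ := by
  intro u
  have hu : u = VectorFourier.fourierIntegral 𝐞 volume scaledInner.toLinearMap₁₂ g := by
    ext1 x
    refine integral_congr_ae (.of_forall fun k => ?_)
    simp only [Circle.smul_def, Real.fourierChar_apply]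
    congr 3
    have hpi : (π : ℂ) ≠ 0 := by simp [pi_ne_zero]
    simp [scaledInner_apply]
    field_simp
  have hi' : ∀ m : ℕ, (m : ℕ∞) ≤ (n : ℕ∞) → Integrable fun k => ‖k‖ ^ m * ‖g k‖ :=
    fun m hm => hi m (by exact_mod_cast hm)
  rw [hu]
  refine ⟨VectorFourier.contDiff_fourierIntegral scaledInner hi', fun x => ?_⟩
  rw [VectorFourier.iteratedFDeriv_fourierIntegral scaledInner hi' hg le_rfl]
  refine norm_integral_le_of_norm_le (hi n le_rfl) (.of_forall fun k => ?_)
  rw [Circle.norm_smul]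
  refine (VectorFourier.norm_fourierPowSMulRight_le scaledInner g k n).trans ?_
  rw [mul_assoc]
  refine mul_le_of_le_one_left (by positivity) (pow_le_one₀ (by positivity) ?_)
  exact two_pi_mul_norm_scaledInner_le

/-- The Cauchy–Schwarz inequality with a nonnegative weight. -/
lemma integral_mul_mul_le_sqrt_mul_sqrt {w f g : E3 → ℝ} (hw : ∀ k, 0 ≤ w k)
    (hf : ∀ k, 0 ≤ f k) (hg : ∀ k, 0 ≤ g k) (hwm : AEStronglyMeasurable w)
    (hfm : AEStronglyMeasurable f) (hgm : AEStronglyMeasurable g)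
    (hfi : Integrable fun k => w k * f k ^ 2) (hgi : Integrable fun k => w k * g k ^ 2) :
    ∫ k, w k * (f k * g k) ≤ √(∫ k, w k * f k ^ 2) * √(∫ k, w k * g k ^ 2) := by
  have hsq : ∀ h : E3 → ℝ, (fun k => (√(w k) * h k) ^ 2) = fun k => w k * h k ^ 2 := fun h => by
    ext k
    rw [mul_pow, Real.sq_sqrt (hw k)]
  have hsm : AEStronglyMeasurable fun k => √(w k) :=
    Real.continuous_sqrt.comp_aestronglyMeasurable hwm
  have hL2 : ∀ {h : E3 → ℝ}, AEStronglyMeasurable h → Integrable (fun k => w k * h k ^ 2) →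
      MemLp (fun k => √(w k) * h k) (ENNReal.ofReal 2) := fun hm hint => by
    rw [ENNReal.ofReal_ofNat, memLp_two_iff_integrable_sq (hsm.fun_mul hm), hsq]
    exact hint
  have key := integral_mul_le_Lp_mul_Lq_of_nonneg Real.HolderConjugate.two_two
    (.of_forall fun k => mul_nonneg (Real.sqrt_nonneg (w k)) (hf k))
    (.of_forall fun k => mul_nonneg (Real.sqrt_nonneg (w k)) (hg k)) (hL2 hfm hfi) (hL2 hgm hgi)
  simp only [Real.rpow_two, ← Real.sqrt_eq_rpow, hsq] at key
  refine le_of_eq_of_le (integral_congr_ae (.of_forall fun k => ?_)) key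
  have := Real.mul_self_sqrt (hw k)
  linear_combination (- (f k * g k)) * this

lemma IsH1Loop.integrable {γ γd : ℝ → E3} (hγ : IsH1Loop γ γd) :
    Integrable γd (volume.restrict (Ioc (0:ℝ) 1)) :=
  hγ.memL2.integrable (by norm_num)

lemma IsH1Loop.aestronglyMeasurable {γ γd : ℝ → E3} (hγ : IsH1Loop γ γd) :
    AEStronglyMeasurable γ (volume.restrict (Ioc (0:ℝ) 1)) := by
  have hcont : ContinuousOn γ (Icc (0:ℝ) 1) := by
    have h : ContinuousOn (fun ξ => γ 0 + ∫ s in (0:ℝ)..ξ, γd s) (Icc (0:ℝ) 1) := by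
      have hI : IntegrableOn γd (uIcc (0:ℝ) 1) := by
        rw [uIcc_of_le zero_le_one, integrableOn_Icc_iff_integrableOn_Ioc]
        exact hγ.integrable
      have := intervalIntegral.continuousOn_primitive_interval hI
      rw [uIcc_of_le zero_le_one] at this
      exact continuousOn_const.add this
    exact h.congr hγ.deriv_eq
  exact (hcont.mono Ioc_subset_Icc_self).aestronglyMeasurable measurableSet_Ioc

/-- The velocity in Fourier variables, before taking the real part. -/
def velocityHat (φhat : E3 → ℝ) (μ : Measure ℝ) (γ γd : ℝ → E3) (k : E3) : C3 :=
  (((2 * π) ^ 3)⁻¹ * φhat k) •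
    complexVec (cross3 k (sinMoment μ γ γd k)) (-cross3 k (cosMoment μ γ γd k))

section VelocityHat

variable {φ φhat : E3 → ℝ} {μ : Measure ℝ} {γ γd : ℝ → E3}

lemma HypA.norm_velocityHat_le (hA : HypA φ φhat) (k : E3) :
    ‖velocityHat φhat μ γ γd k‖ ≤
      ((2 * π) ^ 3)⁻¹ * (φhat k * (‖k‖ * ‖currentHat μ γ γd k‖)) := by
  have h0 := hA.nonneg k
  rw [velocityHat, norm_smul, Real.norm_of_nonneg (by positivity), mul_assoc]
  gcongr
  refine le_of_sq_le_sq ?_ (by positivity)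
  rw [mul_pow, currentHat, norm_complexVec_sq, norm_complexVec_sq, norm_neg, mul_add, ← mul_pow,
    ← mul_pow, add_comm]
  gcongr <;> exact norm_cross3_le _ _

variable [SFinite μ]

lemma HypA.aestronglyMeasurable_velocityHat (hA : HypA φ φhat) (hm : AEStronglyMeasurable γ μ)
    (hd : Integrable γd μ) : AEStronglyMeasurable (velocityHat φhat μ γ γd) := by
  have hcross : ∀ {f : E3 → E3}, AEStronglyMeasurable f →
      AEStronglyMeasurable fun k => cross3 k (f k) := fun hf =>
    crossCLM.continuous₂.comp_aestronglyMeasurable (aestronglyMeasurable_id.prodMk hf)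
  exact (hA.continuous_hat.aestronglyMeasurable.const_mul _).smul
    (continuous_complexVec.comp_aestronglyMeasurable
      ((hcross (aestronglyMeasurable_sinMoment hm hd)).prodMk
        (hcross (aestronglyMeasurable_cosMoment hm hd)).neg))

lemma HypA.integrable_moment_mul_currentHat (hA : HypA φ φhat) (hm : AEStronglyMeasurable γ μ)
    (hd : Integrable γd μ) {n : ℕ}
    (hmom : Integrable fun k : E3 => ‖k‖ ^ (2 * (1 + n)) * φhat k) {m : ℕ} (hmn : m ≤ n) :
    Integrable fun k => φhat k * (‖k‖ ^ (m + 1) * ‖currentHat μ γ γd k‖) := by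
  have hc := hA.continuous_hat
  refine ((hA.integrable_hat.add hmom).add (hA.integrable_currentHat_sq hm hd)).mono'
    (hc.aestronglyMeasurable.mul ((by fun_prop : AEStronglyMeasurable fun k : E3 =>
      ‖k‖ ^ (m + 1)).mul (aestronglyMeasurable_currentHat hm hd).norm)) (.of_forall fun k => ?_)
  have h0 := hA.nonneg k
  rw [Real.norm_of_nonneg (by positivity)]
  have hpow : (‖k‖ ^ (m + 1)) ^ 2 ≤ 1 + ‖k‖ ^ (2 * (1 + n)) := by
    rw [← pow_mul]
    rcases le_total ‖k‖ 1 with h | h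
    · exact (pow_le_one₀ (norm_nonneg k) h).trans (le_add_of_nonneg_right (by positivity))
    · exact (pow_le_pow_right₀ h (by omega)).trans (le_add_of_nonneg_left zero_le_one)
  have hamgm : ‖k‖ ^ (m + 1) * ‖currentHat μ γ γd k‖ ≤
      1 + ‖k‖ ^ (2 * (1 + n)) + ‖currentHat μ γ γd k‖ ^ 2 := by
    nlinarith [sq_nonneg (‖k‖ ^ (m + 1) - ‖currentHat μ γ γd k‖),
      sq_nonneg (‖k‖ ^ (m + 1)), sq_nonneg ‖currentHat μ γ γd k‖]
  calc _ ≤ φhat k * (1 + ‖k‖ ^ (2 * (1 + n)) + ‖currentHat μ γ γd k‖ ^ 2) := by gcongr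
    _ = _ := by simp only [Pi.add_apply]; ring

lemma HypA.integrable_moment_velocityHat (hA : HypA φ φhat) (hm : AEStronglyMeasurable γ μ)
    (hd : Integrable γd μ) {n : ℕ}
    (hmom : Integrable fun k : E3 => ‖k‖ ^ (2 * (1 + n)) * φhat k) {m : ℕ} (hmn : m ≤ n) :
    Integrable fun k => ‖k‖ ^ m * ‖velocityHat φhat μ γ γd k‖ := by
  refine ((hA.integrable_moment_mul_currentHat hm hd hmom hmn).const_mul
    ((2 * π) ^ 3)⁻¹).mono' ((by fun_prop : AEStronglyMeasurable fun k : E3 => ‖k‖ ^ m).mul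
      (hA.aestronglyMeasurable_velocityHat hm hd).norm) (.of_forall fun k => ?_)
  rw [Real.norm_of_nonneg (by positivity)]
  calc _ ≤ ‖k‖ ^ m * (((2 * π) ^ 3)⁻¹ * (φhat k * (‖k‖ * ‖currentHat μ γ γd k‖))) := by
        gcongr
        exact hA.norm_velocityHat_le k
    _ = _ := by ring

lemma HypA.integral_moment_velocityHat_le (hA : HypA φ φhat) (hm : AEStronglyMeasurable γ μ)
    (hd : Integrable γd μ) {n : ℕ}
    (hmom : Integrable fun k : E3 => ‖k‖ ^ (2 * (1 + n)) * φhat k) :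
    ∫ k, ‖k‖ ^ n * ‖velocityHat φhat μ γ γd k‖ ≤
      ((2 * π) ^ 3)⁻¹ * (√(∫ k, ‖k‖ ^ (2 * (1 + n)) * φhat k) *
        √(∫ k, φhat k * ‖currentHat μ γ γd k‖ ^ 2)) := by
  have hpow : (fun k : E3 => ‖k‖ ^ (2 * (1 + n)) * φhat k) =
      fun k => φhat k * (‖k‖ ^ (n + 1)) ^ 2 := by
    ext k
    ring
  calc _ ≤ ∫ k, ((2 * π) ^ 3)⁻¹ * (φhat k * (‖k‖ ^ (n + 1) * ‖currentHat μ γ γd k‖)) := by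
        refine integral_mono (hA.integrable_moment_velocityHat hm hd hmom le_rfl)
          ((hA.integrable_moment_mul_currentHat hm hd hmom le_rfl).const_mul _) fun k => ?_
        calc _ ≤ ‖k‖ ^ n * (((2 * π) ^ 3)⁻¹ * (φhat k * (‖k‖ * ‖currentHat μ γ γd k‖))) :=
              mul_le_mul_of_nonneg_left (hA.norm_velocityHat_le k) (by positivity)
          _ = _ := by ring
    _ ≤ _ := by
        rw [integral_const_mul, hpow]
        rw [hpow] at hmom
        gcongr
        exact integral_mul_mul_le_sqrt_mul_sqrt hA.nonneg (fun k => by positivity)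
          (fun k => by positivity) hA.continuous_hat.aestronglyMeasurable (by fun_prop)
          (aestronglyMeasurable_currentHat hm hd).norm hmom (hA.integrable_currentHat_sq hm hd)

lemma HypA.integral_cross3_gradient_eq_reVec (hA : HypA φ φhat) (hm : AEStronglyMeasurable γ μ)
    (hd : Integrable γd μ) (hi : Integrable (velocityHat φhat μ γ γd)) (x : E3) :
    ∫ ξ, cross3 (gradient φ (x - γ ξ)) (γd ξ) ∂μ =
      reVec (∫ k, Complex.exp (-(inner ℝ k x : ℝ) * Complex.I) • velocityHat φhat μ γ γd k) := by
  have hexp : Integrable fun k =>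
      Complex.exp (-(inner ℝ k x : ℝ) * Complex.I) • velocityHat φhat μ γ γd k := by
    refine hi.norm.mono' ((by fun_prop : AEStronglyMeasurable fun k : E3 =>
      Complex.exp (-(inner ℝ k x : ℝ) * Complex.I)).smul hi.1) (.of_forall fun k => ?_)
    rw [norm_smul, ← Complex.ofReal_neg, Complex.norm_exp_ofReal_mul_I, one_mul]
  rw [← reVec.integral_comp_comm hexp, hA.integral_cross3_gradient hm hd]
  refine integral_congr_ae (.of_forall fun k => ?_)
  simp only [velocityHat]
  rw [smul_comm, map_smul, reVec_exp_smul_complexVec]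

end VelocityHat

lemma inv_two_pi_cube_mul_sqrt (a b : ℝ) :
    ((2 * π) ^ 3)⁻¹ * (a * √b) =
      1 / (2 * π ^ ((3:ℝ) / 2)) * a * √(1 / 2 * (((2 * π) ^ 3)⁻¹ * b)) := by
  have hpi := pi_pos
  set s : ℝ := π ^ ((3:ℝ) / 2) with hs
  have hs0 : 0 < s := by positivity
  have hs2 : s ^ 2 = π ^ 3 := by
    rw [hs, ← Real.rpow_natCast, ← Real.rpow_mul hpi.le, ← Real.rpow_natCast]
    norm_num
  have h : 1 / 2 * (((2 * π) ^ 3)⁻¹ * b) = ((4 * s)⁻¹) ^ 2 * b := by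
    rw [mul_pow, inv_pow, mul_pow, hs2]
    field_simp
    ring
  rw [h, Real.sqrt_mul (by positivity), Real.sqrt_sq (by positivity), mul_pow, ← hs2]
  field_simp
  ring

/-- The velocity induced by an `H¹` closed vortex filament is `n`-times continuously
differentiable, with `sup_x ‖Dⁿu(x)‖ ≤ (1/(2π^{3/2})) (∫ |k|^{2(1+n)} φ̂(k) dk)^{1/2} H(γ)^{1/2}`. -/
theorem velocity_derivative_bound (φ φhat : E3 → ℝ) (hA : HypA φ φhat) (n : ℕ)
    (hmom : Integrable (fun k : E3 => ‖k‖ ^ (2 * (1 + n)) * φhat k))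
    (γ γd : ℝ → E3) (hγ : IsH1Loop γ γd) :
    ContDiff ℝ (n : ℕ∞) (velocity φ γ γd) ∧
      ∀ x : E3, ‖iteratedFDeriv ℝ n (velocity φ γ γd) x‖ ≤
        (1 / (2 * π ^ ((3:ℝ) / 2))) *
          Real.sqrt (∫ k : E3, ‖k‖ ^ (2 * (1 + n)) * φhat k) *
            Real.sqrt (energy φ γ γd) := by
  set μ : Measure ℝ := volume.restrict (Ioc (0:ℝ) 1)
  have hm := hγ.aestronglyMeasurable
  have hd := hγ.integrable
  have hmeas := hA.aestronglyMeasurable_velocityHat hm hd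
  have hi : ∀ m ≤ n, Integrable fun k => ‖k‖ ^ m * ‖velocityHat φhat μ γ γd k‖ :=
    fun m hmn => hA.integrable_moment_velocityHat hm hd hmom hmn
  have hi0 : Integrable (velocityHat φhat μ γ γd) :=
    (integrable_norm_iff hmeas).1 (by simpa using hi 0 n.zero_le)
  obtain ⟨hsmooth, hbound⟩ := contDiff_and_norm_iteratedFDeriv_le hmeas hi
  set U : E3 → C3 := fun x =>
    ∫ k, Complex.exp (-(inner ℝ k x : ℝ) * Complex.I) • velocityHat φhat μ γ γd k
  have hvel : velocity φ γ γd = reVec ∘ U := by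
    ext1 x
    rw [velocity, intervalIntegral.integral_of_le zero_le_one]
    exact hA.integral_cross3_gradient_eq_reVec hm hd hi0 x
  have henergy : energy φ γ γd =
      1 / 2 * (((2 * π) ^ 3)⁻¹ * ∫ k, φhat k * ‖currentHat μ γ γd k‖ ^ 2) := by
    simp only [energy, intervalIntegral.integral_of_le zero_le_one]
    rw [hA.integral_integral_eq hm hd]
  rw [hvel, henergy]
  refine ⟨reVec.contDiff.comp hsmooth, fun x => ?_⟩
  calc ‖iteratedFDeriv ℝ n (reVec ∘ U) x‖ ≤ ‖reVec‖ * ‖iteratedFDeriv ℝ n U x‖ :=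
        reVec.norm_iteratedFDeriv_comp_left hsmooth.contDiffAt le_rfl
    _ ≤ ‖iteratedFDeriv ℝ n U x‖ := mul_le_of_le_one_left (norm_nonneg _) norm_reVec_le
    _ ≤ _ := (hbound x).trans (hA.integral_moment_velocityHat_le hm hd hmom)
    _ = _ := inv_two_pi_cube_mul_sqrt _ _
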